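/- (Stationary memoryless sources, second order at the first-order optimum threshold.) Let X be a stationary memoryless source with generic distribution P_X on 𝒳 such that the third absolute moment of −log P_X(X) is finite and the varentropy satisfies V_X > 0. Then for all ε, δ ∈ [0,1) with 0 < ε + δ < 1, setting R₁ := H(X), it holds that L(ε,δ,R₁|X) = L*(ε,δ,R₁|X) = √V_X · Φ⁻¹(ε+δ). -/

import Mathlib

open Filter MeasureTheory

namespace NY

/-- A probability distribution on a set, given by its point mass function. -/
structure Dist (α : Type*) where
  p : α → ℝ
  nonneg : ∀ x, 0 ≤ p x
  hasSum : HasSum p 1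

/-- The probability of a set under a distribution. -/
noncomputable def Dist.pr {α : Type*} (P : Dist α) (A : Set α) : ℝ := ∑' x : A, P.p x.1

/-- 𝒰* : nonempty finite strings over the code alphabet 𝒰 = {1,…,K}. -/
abbrev Word (K : ℕ) := {u : List (Fin K) // u ≠ []}

/-- Length of a string, as a real number. -/
noncomputable def wlen {K : ℕ} (u : Word K) : ℝ := u.1.length

/-- Error probability of a variable-length code (φ, ψ). -/
noncomputable def errP {α : Type*} {K : ℕ} (P : Dist α) (φ : α → Word K) (ψ : Word K → α) : ℝ :=
  P.pr {x | ψ (φ x) ≠ x}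

/-- Overflow probability of an encoder φ with threshold η. -/
noncomputable def ovP {α : Type*} {K : ℕ} (P : Dist α) (φ : α → Word K) (η : ℝ) : ℝ :=
  P.pr {x | wlen (φ x) > η}

/-- A general source: for each blocklength n, a distribution on 𝒳^n. -/
abbrev Source (𝒳 : Type*) := (n : ℕ) → Dist (Fin n → 𝒳)

/-- The limit as ν ↓ 0 of a function g which is nonincreasing in ν
(the limit exists by monotonicity and equals the supremum over ν > 0). -/
noncomputable def limNu (g : ℝ → ℝ) : ℝ := sSup (g '' Set.Ioi (0 : ℝ))

variable {𝒳 : Type*}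

/-- A rate R ≥ 0 is (ε,δ)-achievable. -/
def FirstAch (K : ℕ) (X : Source 𝒳) (ε δ R : ℝ) : Prop :=
  0 ≤ R ∧ ∃ (φ : ∀ n, (Fin n → 𝒳) → Word K) (ψ : ∀ n, Word K → (Fin n → 𝒳)),
    limsup (fun n => errP (X n) (φ n) (ψ n)) atTop ≤ ε ∧
    limsup (fun n => ovP (X n) (φ n) ((n : ℝ) * R)) atTop ≤ δ

/-- The first-order (ε,δ)-optimum threshold R(ε,δ|X). -/
noncomputable def Ropt (K : ℕ) (X : Source 𝒳) (ε δ : ℝ) : ℝ :=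
  sInf {R | FirstAch K X ε δ R}

/-- L is (ε,δ,R)-achievable (second order). -/
def SecondAch (K : ℕ) (X : Source 𝒳) (ε δ R L : ℝ) : Prop :=
  ∃ (φ : ∀ n, (Fin n → 𝒳) → Word K) (ψ : ∀ n, Word K → (Fin n → 𝒳)),
    limsup (fun n => errP (X n) (φ n) (ψ n)) atTop ≤ ε ∧
    limsup (fun n => ovP (X n) (φ n) ((n : ℝ) * R + Real.sqrt (n : ℝ) * L)) atTop ≤ δ

/-- The second-order (ε,δ,R)-optimum threshold L(ε,δ,R|X). -/
noncomputable def Lopt (K : ℕ) (X : Source 𝒳) (ε δ R : ℝ) : ℝ :=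
  sInf {L | SecondAch K X ε δ R L}

/-- A rate R ≥ 0 is optimistically (ε,δ)-achievable. -/
def OptFirstAch (K : ℕ) (X : Source 𝒳) (ε δ R : ℝ) : Prop :=
  0 ≤ R ∧ ∃ (φ : ∀ n, (Fin n → 𝒳) → Word K) (ψ : ∀ n, Word K → (Fin n → 𝒳)),
    ∀ γ > (0 : ℝ), ∃ ns : ℕ → ℕ, StrictMono ns ∧ ∀ i,
      errP (X (ns i)) (φ (ns i)) (ψ (ns i)) ≤ ε + γ ∧
      ovP (X (ns i)) (φ (ns i)) ((ns i : ℝ) * R) ≤ δ + γ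

/-- The optimistic first-order (ε,δ)-optimum threshold R*(ε,δ|X). -/
noncomputable def RoptStar (K : ℕ) (X : Source 𝒳) (ε δ : ℝ) : ℝ :=
  sInf {R | OptFirstAch K X ε δ R}

/-- L is optimistically (ε,δ,R)-achievable. -/
def OptSecondAch (K : ℕ) (X : Source 𝒳) (ε δ R L : ℝ) : Prop :=
  ∃ (φ : ∀ n, (Fin n → 𝒳) → Word K) (ψ : ∀ n, Word K → (Fin n → 𝒳)),
    ∀ γ > (0 : ℝ), ∃ ns : ℕ → ℕ, StrictMono ns ∧ ∀ i,
      errP (X (ns i)) (φ (ns i)) (ψ (ns i)) ≤ ε + γ ∧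
      ovP (X (ns i)) (φ (ns i)) ((ns i : ℝ) * R + Real.sqrt (ns i : ℝ) * L) ≤ δ + γ

/-- The optimistic second-order (ε,δ,R)-optimum threshold L*(ε,δ,R|X). -/
noncomputable def LoptStar (K : ℕ) (X : Source 𝒳) (ε δ R : ℝ) : ℝ :=
  sInf {L | OptSecondAch K X ε δ R L}

/-- A rate R ≥ 0 is type I (ε,δ)-achievable. -/
def TypeIAch (K : ℕ) (X : Source 𝒳) (ε δ R : ℝ) : Prop :=
  0 ≤ R ∧ ∃ (φ : ∀ n, (Fin n → 𝒳) → Word K) (ψ : ∀ n, Word K → (Fin n → 𝒳)),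
    limsup (fun n => errP (X n) (φ n) (ψ n)) atTop ≤ ε ∧
    liminf (fun n => ovP (X n) (φ n) ((n : ℝ) * R)) atTop ≤ δ

/-- R†(ε,δ|X). -/
noncomputable def Rdagger (K : ℕ) (X : Source 𝒳) (ε δ : ℝ) : ℝ :=
  sInf {R | TypeIAch K X ε δ R}

/-- A rate R ≥ 0 is type II (ε,δ)-achievable. -/
def TypeIIAch (K : ℕ) (X : Source 𝒳) (ε δ R : ℝ) : Prop :=
  0 ≤ R ∧ ∃ (φ : ∀ n, (Fin n → 𝒳) → Word K) (ψ : ∀ n, Word K → (Fin n → 𝒳)),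
    liminf (fun n => errP (X n) (φ n) (ψ n)) atTop ≤ ε ∧
    limsup (fun n => ovP (X n) (φ n) ((n : ℝ) * R)) atTop ≤ δ

/-- R‡(ε,δ|X). -/
noncomputable def Rddagger (K : ℕ) (X : Source 𝒳) (ε δ : ℝ) : ℝ :=
  sInf {R | TypeIIAch K X ε δ R}

/-- H̄_γ(X) := inf{ R : limsup_n Pr{ (1/n) log(1/P_{X^n}(X^n)) > R } ≤ γ }. -/
noncomputable def Hbar (K : ℕ) (X : Source 𝒳) (γ : ℝ) : ℝ :=
  sInf {R | limsup (fun n =>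
    (X n).pr {x | Real.logb (K : ℝ) (1 / (X n).p x) / (n : ℝ) > R}) atTop ≤ γ}

/-- H̄*_γ(X) (optimistic version, with liminf). -/
noncomputable def HbarStar (K : ℕ) (X : Source 𝒳) (γ : ℝ) : ℝ :=
  sInf {R | liminf (fun n =>
    (X n).pr {x | Real.logb (K : ℝ) (1 / (X n).p x) / (n : ℝ) > R}) atTop ≤ γ}

/-- H̄_γ(R|X) := inf{ L : limsup_n Pr{ (1/n) log(1/P_{X^n}(X^n)) > R + L/√n } ≤ γ }. -/
noncomputable def Hbar2 (K : ℕ) (X : Source 𝒳) (γ R : ℝ) : ℝ :=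
  sInf {L | limsup (fun n =>
    (X n).pr {x | Real.logb (K : ℝ) (1 / (X n).p x) / (n : ℝ)
      > R + L / Real.sqrt (n : ℝ)}) atTop ≤ γ}

/-- H̄*_γ(R|X) (optimistic version, with liminf). -/
noncomputable def Hbar2Star (K : ℕ) (X : Source 𝒳) (γ R : ℝ) : ℝ :=
  sInf {L | liminf (fun n =>
    (X n).pr {x | Real.logb (K : ℝ) (1 / (X n).p x) / (n : ℝ)
      > R + L / Real.sqrt (n : ℝ)}) atTop ≤ γ}

/-- F(ε,R) := limsup_n inf_{A : Pr(A) ≥ 1−ε} Pr{ −(1/n) log P_{X^n}(X^n) ≥ R, X^n ∈ A }. -/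
noncomputable def Fspec (K : ℕ) (X : Source 𝒳) (ε R : ℝ) : ℝ :=
  limsup (fun n =>
    sInf ((fun A : Set (Fin n → 𝒳) =>
        (X n).pr (A ∩ {x | -Real.logb (K : ℝ) ((X n).p x) / (n : ℝ) ≥ R})) ''
      {A | (X n).pr A ≥ 1 - ε})) atTop

/-- H̃_{ε,δ}(X) := inf{ R : F(ε,R) ≤ δ }. -/
noncomputable def Htilde (K : ℕ) (X : Source 𝒳) (ε δ : ℝ) : ℝ :=
  sInf {R | Fspec K X ε R ≤ δ}

/-- G_{ε,δ}(X). -/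
noncomputable def Gfirst (K : ℕ) (X : Source 𝒳) (ε δ : ℝ) : ℝ :=
  sInf {R | limNu (fun ν => limsup (fun n =>
    sInf ((fun A : Set (Fin n → 𝒳) =>
        (X n).pr (A ∩ {x | -Real.logb (K : ℝ) ((X n).p x / (X n).pr A) / (n : ℝ) ≥ R})) ''
      {A | (X n).pr A ≥ 1 - ε - ν})) atTop) ≤ δ}

/-- G*_{ε,δ}(X) (optimistic version, with liminf). -/
noncomputable def GfirstStar (K : ℕ) (X : Source 𝒳) (ε δ : ℝ) : ℝ :=
  sInf {R | limNu (fun ν => liminf (fun n =>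
    sInf ((fun A : Set (Fin n → 𝒳) =>
        (X n).pr (A ∩ {x | -Real.logb (K : ℝ) ((X n).p x / (X n).pr A) / (n : ℝ) ≥ R})) ''
      {A | (X n).pr A ≥ 1 - ε - ν})) atTop) ≤ δ}

/-- G_{ε,δ}(R|X). -/
noncomputable def Gsecond (K : ℕ) (X : Source 𝒳) (ε δ R : ℝ) : ℝ :=
  sInf {L | limNu (fun ν => limsup (fun n =>
    sInf ((fun A : Set (Fin n → 𝒳) =>
        (X n).pr (A ∩ {x | -Real.logb (K : ℝ) ((X n).p x / (X n).pr A) / (n : ℝ)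
          ≥ R + L / Real.sqrt (n : ℝ)})) ''
      {A | (X n).pr A ≥ 1 - ε - ν})) atTop) ≤ δ}

/-- G*_{ε,δ}(R|X) (optimistic version, with liminf). -/
noncomputable def GsecondStar (K : ℕ) (X : Source 𝒳) (ε δ R : ℝ) : ℝ :=
  sInf {L | limNu (fun ν => liminf (fun n =>
    sInf ((fun A : Set (Fin n → 𝒳) =>
        (X n).pr (A ∩ {x | -Real.logb (K : ℝ) ((X n).p x / (X n).pr A) / (n : ℝ)
          ≥ R + L / Real.sqrt (n : ℝ)})) ''
      {A | (X n).pr A ≥ 1 - ε - ν})) atTop) ≤ δ}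

/-- A rate R is optimistically ε-achievable by fixed-length codes. -/
def FixAchR (K : ℕ) (X : Source 𝒳) (ε R : ℝ) : Prop :=
  ∃ (M : ℕ → ℕ) (φ : ∀ n, (Fin n → 𝒳) → Fin (M n)) (ψ : ∀ n, Fin (M n) → (Fin n → 𝒳)),
    ∀ γ > (0 : ℝ), ∃ ns : ℕ → ℕ, StrictMono ns ∧ ∀ i,
      (X (ns i)).pr {x | ψ (ns i) (φ (ns i) x) ≠ x} ≤ ε + γ ∧
      Real.logb (K : ℝ) (M (ns i) : ℝ) / (ns i : ℝ) ≤ R + γ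

/-- R^f(ε|X). -/
noncomputable def Rfix (K : ℕ) (X : Source 𝒳) (ε : ℝ) : ℝ :=
  sInf {R | FixAchR K X ε R}

/-- A real L is optimistically (ε,R)-achievable by fixed-length codes. -/
def FixAchL (K : ℕ) (X : Source 𝒳) (ε R L : ℝ) : Prop :=
  ∃ (M : ℕ → ℕ) (φ : ∀ n, (Fin n → 𝒳) → Fin (M n)) (ψ : ∀ n, Fin (M n) → (Fin n → 𝒳)),
    ∀ γ > (0 : ℝ), ∃ ns : ℕ → ℕ, StrictMono ns ∧ ∀ i,
      (X (ns i)).pr {x | ψ (ns i) (φ (ns i) x) ≠ x} ≤ ε + γ ∧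
      Real.logb (K : ℝ) ((M (ns i) : ℝ) / (K : ℝ) ^ ((ns i : ℝ) * R)) / Real.sqrt (ns i : ℝ)
        ≤ L + γ

/-- L^f(ε,R|X). -/
noncomputable def Lfix (K : ℕ) (X : Source 𝒳) (ε R : ℝ) : ℝ :=
  sInf {L | FixAchL K X ε R L}

/-- The complementary standard Gaussian distribution function
Φ(x) = (1/√(2π)) ∫_x^∞ e^{−t²/2} dt. -/
noncomputable def PhiC (x : ℝ) : ℝ :=
  (Real.sqrt (2 * Real.pi))⁻¹ * ∫ t in Set.Ioi x, Real.exp (-(t ^ 2) / 2)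

/-- The inverse Φ⁻¹ of Φ on (0,1). -/
noncomputable def PhiCInv (y : ℝ) : ℝ := Function.invFun PhiC y

section Phi
open ProbabilityTheory Topology

lemma PhiC_eq (x : ℝ) : PhiC x = (gaussianReal 0 1).real (Set.Ioi x) := by
  rw [measureReal_def, gaussianReal_apply_eq_integral _ one_ne_zero, ENNReal.toReal_ofReal]
  · rw [PhiC, ← integral_const_mul]
    congr 1
    ext t
    simp [gaussianPDFReal]
  · exact integral_nonneg fun t => gaussianPDFReal_nonneg _ _ _

lemma PhiC_eq_cdf (x : ℝ) : PhiC x = 1 - cdf (gaussianReal 0 1) x := by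
  rw [PhiC_eq, cdf_eq_real, ← Set.compl_Iic, measureReal_compl measurableSet_Iic]
  simp

lemma PhiC_strictAnti : StrictAnti PhiC := by
  intro a b hab
  rw [PhiC_eq, PhiC_eq, ← Set.Ioc_union_Ioi_eq_Ioi hab.le,
    measureReal_union (Set.Ioc_disjoint_Ioi le_rfl) measurableSet_Ioi]
  have : 0 < (gaussianReal 0 1).real (Set.Ioc a b) := by
    rw [measureReal_def]
    refine ENNReal.toReal_pos ?_ (measure_ne_top _ _)
    intro h
    have := gaussianReal_absolutelyContinuous' 0 (v := 1) one_ne_zero h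
    simp at this
    linarith
  linarith

lemma PhiC_continuous : Continuous PhiC := by
  have h : PhiC = fun x => (Real.sqrt (2 * Real.pi))⁻¹ * ((∫ t, Real.exp (-(t ^ 2) / 2)) - ∫ t in Set.Iic x, Real.exp (-(t ^ 2) / 2)) := by
    have hi : Integrable (fun t : ℝ => Real.exp (-(t ^ 2) / 2)) := by
      have := integrable_exp_neg_mul_sq (b := 1/2) (by norm_num)
      refine this.congr (ae_of_all _ fun t => ?_)
      dsimp only
      congr 1; ring
    ext x
    rw [PhiC, ← intervalIntegral.integral_Iic_add_Ioi (b := x) hi.integrableOn hi.integrableOn]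
    ring
  have hi : Integrable (fun t : ℝ => Real.exp (-(t ^ 2) / 2)) := by
    have := integrable_exp_neg_mul_sq (b := 1/2) (by norm_num)
    refine this.congr (ae_of_all _ fun t => ?_)
    dsimp only
    congr 1; ring
  rw [h]
  refine continuous_const.mul (continuous_const.sub ?_)
  have h2 : (fun x => ∫ t in Set.Iic x, Real.exp (-(t ^ 2) / 2)) = fun x : ℝ => (∫ t in Set.Iic (0:ℝ), Real.exp (-(t ^ 2) / 2)) + ∫ t in (0:ℝ)..x, Real.exp (-(t ^ 2) / 2) := by
    ext x
    rw [← intervalIntegral.integral_Iic_sub_Iic hi.integrableOn hi.integrableOn]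
    ring
  rw [h2]
  exact continuous_const.add (intervalIntegral.continuous_primitive (fun a b => hi.intervalIntegrable) 0)

lemma PhiC_PhiCInv {y : ℝ} (h0 : 0 < y) (h1 : y < 1) : PhiC (PhiCInv y) = y := by
  apply Function.invFun_eq
  have ht : Tendsto PhiC atTop (𝓝 0) := by
    have := (tendsto_cdf_atTop (gaussianReal 0 1)).const_sub 1
    simpa [funext PhiC_eq_cdf] using this
  have hb : Tendsto PhiC atBot (𝓝 1) := by
    have := (tendsto_cdf_atBot (gaussianReal 0 1)).const_sub 1
    simpa [funext PhiC_eq_cdf] using this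
  obtain ⟨a, ha⟩ := (ht.eventually_lt_const h0).exists
  obtain ⟨b, hb⟩ := (hb.eventually_const_lt h1).exists
  have := mem_range_of_exists_le_of_exists_ge PhiC_continuous ⟨a, ha.le⟩ ⟨b, hb.le⟩
  exact this
end Phi

section Pr
variable {α : Type*} (P : Dist α)

lemma pr_eq (A : Set α) : P.pr A = ∑' x, A.indicator P.p x := by
  rw [Dist.pr, tsum_subtype]

lemma summ (A : Set α) : Summable (A.indicator P.p) := P.hasSum.summable.indicator A

lemma pr_nonneg (A : Set α) : 0 ≤ P.pr A := tsum_nonneg fun x => P.nonneg _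

lemma pr_mono {A B : Set α} (h : A ⊆ B) : P.pr A ≤ P.pr B := by
  rw [pr_eq, pr_eq]
  exact (summ P A).tsum_le_tsum (fun x => Set.indicator_le_indicator_of_subset h P.nonneg x) (summ P B)

lemma pr_union_le (A B : Set α) : P.pr (A ∪ B) ≤ P.pr A + P.pr B := by
  rw [pr_eq, pr_eq, pr_eq, ← (summ P A).tsum_add (summ P B)]
  refine (summ P _).tsum_le_tsum (fun x => ?_) ((summ P A).add (summ P B))
  have := P.nonneg x
  by_cases ha : x ∈ A <;> by_cases hb : x ∈ B <;> simp [ha, hb, this]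

lemma pr_compl (A : Set α) : P.pr A + P.pr Aᶜ = 1 := by
  rw [pr_eq, pr_eq, ← (summ P A).tsum_add (summ P _), ← P.hasSum.tsum_eq]
  congr 1
  ext x
  exact congrFun (Set.indicator_self_add_compl A P.p) x

lemma pr_le_one (A : Set α) : P.pr A ≤ 1 := by
  have := pr_compl P A
  have := pr_nonneg P Aᶜ
  linarith

lemma pr_finset (F : Finset α) : P.pr (F : Set α) = ∑ x ∈ F, P.p x := by
  rw [Dist.pr]
  exact F.tsum_subtype P.p

lemma pr_inter_add_diff (A B : Set α) : P.pr (A ∩ B) + P.pr (A \ B) = P.pr A := by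
  rw [pr_eq, pr_eq, pr_eq, ← (summ P _).tsum_add (summ P _)]
  congr 1
  ext x
  by_cases ha : x ∈ A <;> by_cases hb : x ∈ B <;> simp [ha, hb]

/-- the greedy split -/
lemma pr_split (A : Set α) (τ δ : ℝ) (hτ : 0 ≤ τ) (hδ : 0 ≤ δ) (hA : ∀ x ∈ A, P.p x ≤ τ) :
    ∃ C ⊆ A, P.pr C ≤ δ + τ ∧ P.pr (A \ C) ≤ max (P.pr A - δ) 0 := by
  classical
  by_cases h : P.pr A ≤ δ
  · refine ⟨A, subset_rfl, by linarith, ?_⟩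
    simp [Dist.pr]
  push Not at h
  have hex : ∃ k : ℕ, ∃ F : Finset α, F.card = k ∧ (F : Set α) ⊆ A ∧ δ ≤ P.pr F := by
    have hs := (summ P A).hasSum
    rw [← pr_eq] at hs
    obtain ⟨F, hF⟩ := (hs.eventually_const_lt h).exists
    refine ⟨_, F.filter (· ∈ A), rfl, fun x hx => by simpa using (by simpa using hx : x ∈ F ∧ x ∈ A).2, ?_⟩
    rw [pr_finset, Finset.sum_filter]
    refine hF.le.trans (le_of_eq ?_)
    refine Finset.sum_congr rfl fun x _ => ?_
    simp [Set.indicator_apply]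
  obtain ⟨F, hc, hFA, hF⟩ := Nat.find_spec hex
  refine ⟨F, hFA, ?_, ?_⟩
  · rcases F.eq_empty_or_nonempty with rfl | ⟨a, ha⟩
    · simp [Dist.pr]; linarith
    · have hlt : P.pr (F.erase a : Finset α) < δ := by
        by_contra hcon
        push Not at hcon
        refine Nat.find_min hex (m := (F.erase a).card) ?_ ⟨F.erase a, rfl, ?_, hcon⟩
        · rw [← hc]; exact Finset.card_erase_lt_of_mem ha
        · exact fun x hx => hFA (by simpa using (by simpa using hx : x ∈ F ∧ ¬ x = a).1)
      rw [pr_finset] at hlt ⊢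
      rw [← Finset.add_sum_erase F _ ha]
      linarith [hA a (hFA ha)]
  · have := pr_inter_add_diff P A F
    rw [Set.inter_eq_self_of_subset_right hFA] at this
    exact le_max_of_le_left (by linarith)

lemma pr_eq_measure [Countable α] [MeasurableSpace α] [DiscreteMeasurableSpace α]
    (μ : Measure α) [IsProbabilityMeasure μ] (h : ∀ x, μ.real {x} = P.p x) (A : Set α) :
    P.pr A = μ.real A := by
  rw [pr_eq, measureReal_def, ← μ.tsum_indicator_apply_singleton A (MeasurableSet.of_discrete),
    ENNReal.tsum_toReal_eq]
  · congr 1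
    ext x
    by_cases hx : x ∈ A <;> simp [hx, ← h, measureReal_def]
  · intro x
    by_cases hx : x ∈ A <;> simp [hx]

end Pr

section CLT
open ProbabilityTheory Topology

lemma integrable_of_summ {α : Type*} [Countable α] [MeasurableSpace α] [DiscreteMeasurableSpace α]
    (P : Dist α) (μ : Measure α) [IsProbabilityMeasure μ] (h : ∀ x, μ.real {x} = P.p x)
    (f : α → ℝ) (hf : Summable fun x => P.p x * |f x|) : Integrable f μ := by
  refine ⟨(measurable_of_countable f).aestronglyMeasurable, ?_⟩
  rw [HasFiniteIntegral, lintegral_countable']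
  have : ∀ x, ‖f x‖ₑ * μ {x} = ENNReal.ofReal (P.p x * |f x|) := by
    intro x
    rw [← h, ENNReal.ofReal_mul measureReal_nonneg, measureReal_def,
      ENNReal.ofReal_toReal (measure_ne_top _ _), mul_comm, Real.enorm_eq_ofReal_abs]
  simp_rw [this]
  exact hf.tsum_ofReal_lt_top

lemma integral_of_summ {α : Type*} [Countable α] [MeasurableSpace α] [DiscreteMeasurableSpace α]
    (P : Dist α) (μ : Measure α) [IsProbabilityMeasure μ] (h : ∀ x, μ.real {x} = P.p x)
    (f : α → ℝ) (hf : Summable fun x => P.p x * |f x|) : ∫ x, f x ∂μ = ∑' x, P.p x * f x := by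
  rw [integral_countable' (integrable_of_summ P μ h f hf)]
  simp [h]

lemma clt_aux {𝒳 : Type*} [Countable 𝒳] [MeasurableSpace 𝒳] [DiscreteMeasurableSpace 𝒳]
    (K : ℕ) (hK : 2 ≤ K)
    (pX : Dist 𝒳) (μ : Measure 𝒳) [IsProbabilityMeasure μ] (hμ : ∀ x, μ.real {x} = pX.p x)
    (X : Source 𝒳)
    (hX : ∀ (n : ℕ) (x : Fin n → 𝒳), (X n).p x = ∏ i, pX.p (x i))
    (hmom : Summable fun x => pX.p x * |Real.logb (K : ℝ) (1 / pX.p x)| ^ 3)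
    (H V : ℝ) (hH : H = ∑' x, pX.p x * Real.logb (K : ℝ) (1 / pX.p x))
    (hV : V = ∑' x, pX.p x * (-Real.logb (K : ℝ) (pX.p x) - H) ^ 2) (hVpos : 0 < V) (L : ℝ) :
    Tendsto (fun n : ℕ => (X n).pr {x | (X n).p x < (K : ℝ) ^ (-((n : ℝ) * H + Real.sqrt n * L))})
      atTop (𝓝 (PhiC (L / Real.sqrt V))) := by
  have hK1 : (1 : ℝ) < K := by exact_mod_cast hK
  set Y : 𝒳 → ℝ := fun x => -Real.logb (K : ℝ) (pX.p x) with hY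
  have hYeq : ∀ x, Real.logb (K : ℝ) (1 / pX.p x) = Y x := by
    intro x; simp [hY]
  simp_rw [hYeq] at hmom hH
  have hp := pX.hasSum.summable
  -- summability
  have hs2 : Summable fun x => pX.p x * |Y x| ^ 2 := by
    refine Summable.of_nonneg_of_le (fun x => mul_nonneg (pX.nonneg x) (by positivity))
      (fun x => ?_) (hp.add hmom)
    have h1 : |Y x| ^ 2 ≤ 1 + |Y x| ^ 3 := by
      have := abs_nonneg (Y x)
      rcases le_total (|Y x|) 1 with h | h
      · nlinarith [pow_nonneg this 3]
      · nlinarith [pow_nonneg this 2]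
    nlinarith [mul_le_mul_of_nonneg_left h1 (pX.nonneg x)]
  have hs1 : Summable fun x => pX.p x * |Y x| := by
    refine Summable.of_nonneg_of_le (fun x => mul_nonneg (pX.nonneg x) (by positivity))
      (fun x => ?_) (hp.add hs2)
    have h1 : |Y x| ≤ 1 + |Y x| ^ 2 := by
      nlinarith [sq_nonneg (|Y x| - 1), abs_nonneg (Y x)]
    nlinarith [mul_le_mul_of_nonneg_left h1 (pX.nonneg x)]
  have hintY : Integrable Y μ := integrable_of_summ pX μ hμ Y hs1
  have hEY : ∫ x, Y x ∂μ = H := by rw [integral_of_summ pX μ hμ Y hs1, hH]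
  have hEV : ∫ x, (Y x - H) ^ 2 ∂μ = V := by
    rw [integral_of_summ pX μ hμ _ ?_, hV]
    refine Summable.of_nonneg_of_le (fun x => mul_nonneg (pX.nonneg x) (by positivity))
      (fun x => ?_) ((hs2.mul_left 2).add (hp.mul_left (2 * H ^ 2)))
    have h1 : |(Y x - H) ^ 2| ≤ 2 * |Y x| ^ 2 + 2 * H ^ 2 := by
      rw [abs_of_nonneg (by positivity), sq_abs]
      nlinarith [sq_nonneg (Y x + H)]
    nlinarith [mul_le_mul_of_nonneg_left h1 (pX.nonneg x)]
  have hsV : 0 < Real.sqrt V := Real.sqrt_pos.2 hVpos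
  set Z : 𝒳 → ℝ := fun x => (Y x - H) / Real.sqrt V with hZ
  have hZm : Measurable Z := measurable_of_countable Z
  have hEZ : ∫ x, Z x ∂μ = 0 := by
    simp only [hZ]
    rw [integral_div, integral_sub hintY (integrable_const _), hEY]
    simp
  have hEZ2 : ∫ x, Z x ^ 2 ∂μ = 1 := by
    simp only [hZ, div_pow]
    rw [integral_div, hEV, Real.sq_sqrt hVpos.le, div_self hVpos.ne']
  set Q : Measure (ℕ → 𝒳) := Measure.infinitePi (fun _ => μ) with hQ
  have hev : ∀ i, Q.map (fun ω => ω i) = μ := fun i => Measure.infinitePi_map_eval (fun _ : ℕ => μ) i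
  have hmev : ∀ i : ℕ, Measurable (fun ω : ℕ → 𝒳 => ω i) := fun i => measurable_pi_apply i
  have hclt := tendstoInDistribution_inv_sqrt_mul_sum (P := Q) (P' := gaussianReal 0 1)
    (Y := id) (X := fun i ω => Z (ω i)) HasLaw.id ?_ ?_ ?_ ?_
  rotate_left
  · have := integral_map (μ := Q) (hmev 0).aemeasurable (f := Z) hZm.aestronglyMeasurable
    rw [hev, hEZ] at this
    exact this.symm
  · have := integral_map (μ := Q) (hmev 0).aemeasurable (f := fun x => Z x ^ 2)
      (hZm.pow_const 2).aestronglyMeasurable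
    rw [hev, hEZ2] at this
    exact this.symm
  · exact iIndepFun_infinitePi (X := fun _ => Z) (fun _ => hZm)
  · intro i
    refine ⟨(hZm.comp (hmev i)).aemeasurable, (hZm.comp (hmev 0)).aemeasurable, ?_⟩
    have h1 : ∀ i, Q.map (fun ω => Z (ω i)) = μ.map Z := by
      intro i
      rw [← hev i, Measure.map_map hZm (hmev i)]
      rfl
    rw [h1, h1]
  have hport := ProbabilityMeasure.tendsto_measure_of_null_frontier_of_tendsto'
    hclt.tendsto (E := Set.Ioi (L / Real.sqrt V)) ?_
  swap
  · haveI := nullSingletonClass_gaussianReal (μ := 0) (v := 1) one_ne_zero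
    simp
  simp only [ProbabilityMeasure.coe_mk, Measure.map_id] at hport
  have hreal := (ENNReal.tendsto_toReal (measure_ne_top _ _)).comp hport
  rw [PhiC_eq]
  refine Tendsto.congr' ?_ hreal
  filter_upwards [eventually_gt_atTop 0] with n hn
  have hnr : (0 : ℝ) < n := by exact_mod_cast hn
  have hmeas : ∀ x : Fin n → 𝒳, (Measure.infinitePi (fun _ : Fin n => μ)).real {x} = (X n).p x := by
    intro x
    rw [hX, measureReal_def, Measure.infinitePi_singleton_of_fintype, ENNReal.toReal_prod]
    exact Finset.prod_congr rfl fun i _ => hμ _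
  rw [pr_eq_measure (X n) _ hmeas, ← Measure.map_infinitePi_infinitePi_of_inj
    (P := fun _ : ℕ => μ) (f := fun i : Fin n => (i : ℕ)) Fin.val_injective]
  rw [measureReal_def, Measure.map_apply (by fun_prop) MeasurableSet.of_discrete]
  simp only [Function.comp]
  have hmS : Measurable (fun ω : ℕ → 𝒳 => (Real.sqrt n)⁻¹ * ∑ k ∈ Finset.range n, Z (ω k)) :=
    Measurable.const_mul (Finset.measurable_fun_sum _ fun i _ => hZm.comp (hmev i)) _
  rw [Measure.map_apply hmS measurableSet_Ioi]
  congr 1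
  apply measure_congr
  have hpos : ∀ᵐ ω ∂Q, ∀ i : ℕ, 0 < pX.p (ω i) := by
    rw [ae_all_iff]
    intro i
    have : ∀ᵐ x ∂μ, 0 < pX.p x := by
      rw [ae_iff_of_countable]
      intro x hx
      rw [← hμ]
      exact ENNReal.toReal_pos hx (measure_ne_top _ _)
    rw [← hev i] at this
    exact ae_of_ae_map (hmev i).aemeasurable this
  filter_upwards [hpos] with ω hω
  have hsn : 0 < Real.sqrt n := Real.sqrt_pos.2 hnr
  have hsum : ∑ k ∈ Finset.range n, Z (ω k) =
      (∑ k ∈ Finset.range n, Y (ω k) - n * H) / Real.sqrt V := by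
    simp only [hZ]
    rw [← Finset.sum_div, Finset.sum_sub_distrib]
    simp
  have hlog : ∑ k ∈ Finset.range n, Y (ω k) = - Real.logb K (∏ i : Fin n, pX.p (ω i)) := by
    rw [Real.logb_prod (s := Finset.univ) (f := fun i : Fin n => pX.p (ω i)) (fun i _ => (hω i).ne'), Finset.sum_range, ← Finset.sum_neg_distrib]
  have hprod : 0 < ∏ i : Fin n, pX.p (ω i) := Finset.prod_pos fun i _ => hω i
  have key : (L / Real.sqrt V < (Real.sqrt n)⁻¹ * ∑ k ∈ Finset.range n, Z (ω k)) ↔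
      ((X n).p (fun i : Fin n => ω i) < (K : ℝ) ^ (-((n : ℝ) * H + Real.sqrt n * L))) := by
    rw [hX, ← Real.logb_lt_iff_lt_rpow hK1 hprod, hsum, hlog, ← mul_div_assoc,
      div_lt_div_iff_of_pos_right hsV, inv_mul_eq_div, lt_div_iff₀ hsn]
    constructor <;> intro h <;> linarith
  exact propext key

lemma clt {𝒳 : Type*} [Countable 𝒳]
    (K : ℕ) (hK : 2 ≤ K) (pX : Dist 𝒳) (X : Source 𝒳)
    (hX : ∀ (n : ℕ) (x : Fin n → 𝒳), (X n).p x = ∏ i, pX.p (x i))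
    (hmom : Summable fun x => pX.p x * |Real.logb (K : ℝ) (1 / pX.p x)| ^ 3)
    (H V : ℝ) (hH : H = ∑' x, pX.p x * Real.logb (K : ℝ) (1 / pX.p x))
    (hV : V = ∑' x, pX.p x * (-Real.logb (K : ℝ) (pX.p x) - H) ^ 2) (hVpos : 0 < V) (L : ℝ) :
    Tendsto (fun n : ℕ => (X n).pr {x | (X n).p x < (K : ℝ) ^ (-((n : ℝ) * H + Real.sqrt n * L))})
      atTop (𝓝 (PhiC (L / Real.sqrt V))) := by
  letI : MeasurableSpace 𝒳 := ⊤
  let p : PMF 𝒳 := ⟨fun x => ENNReal.ofReal (pX.p x), by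
    have := ENNReal.summable (f := fun x => ENNReal.ofReal (pX.p x))
    rw [this.hasSum_iff, ← ENNReal.ofReal_tsum_of_nonneg pX.nonneg pX.hasSum.summable,
      pX.hasSum.tsum_eq, ENNReal.ofReal_one]⟩
  refine clt_aux K hK pX p.toMeasure (fun x => ?_) X hX hmom H V hH hV hVpos L
  rw [measureReal_def, PMF.toMeasure_apply_singleton _ _ (MeasurableSet.singleton _)]
  exact ENNReal.toReal_ofReal (pX.nonneg x)

lemma H_pos {𝒳 : Type*} (K : ℕ) (hK : 2 ≤ K) (pX : Dist 𝒳)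
    (hmom : Summable fun x => pX.p x * |Real.logb (K : ℝ) (1 / pX.p x)| ^ 3)
    (H V : ℝ) (hH : H = ∑' x, pX.p x * Real.logb (K : ℝ) (1 / pX.p x))
    (hV : V = ∑' x, pX.p x * (-Real.logb (K : ℝ) (pX.p x) - H) ^ 2) (hVpos : 0 < V) :
    0 < H := by
  have hK1 : (1 : ℝ) < K := by exact_mod_cast hK
  have hp1 : ∀ x, pX.p x ≤ 1 := fun x => by
    rw [← pX.hasSum.tsum_eq]; exact pX.hasSum.summable.le_tsum x (fun y _ => pX.nonneg y)
  have hl : ∀ x, 0 ≤ Real.logb (K : ℝ) (1 / pX.p x) := by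
    intro x
    rw [one_div, Real.logb_inv]
    have := Real.logb_nonpos (b := K) hK1 (pX.nonneg x) (hp1 x)
    linarith
  have hn : ∀ x, 0 ≤ pX.p x * Real.logb (K : ℝ) (1 / pX.p x) := fun x => mul_nonneg (pX.nonneg x) (hl x)
  have hs : Summable fun x => pX.p x * Real.logb (K : ℝ) (1 / pX.p x) := by
    refine Summable.of_nonneg_of_le hn (fun x => ?_) (pX.hasSum.summable.add hmom)
    set y := Real.logb (K : ℝ) (1 / pX.p x) with hy
    have hy0 : 0 ≤ y := hl x
    have h1 : y ≤ 1 + |y| ^ 3 := by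
      rw [abs_of_nonneg hy0]
      rcases le_total y 1 with h | h
      · nlinarith [pow_nonneg hy0 3]
      · nlinarith [pow_nonneg hy0 2, mul_nonneg hy0 (sub_nonneg.2 h), mul_nonneg (mul_nonneg hy0 hy0) (sub_nonneg.2 h)]
    nlinarith [mul_le_mul_of_nonneg_left h1 (pX.nonneg x)]
  rw [hH]
  rcases (tsum_nonneg hn).lt_or_eq with h | h
  · exact h
  exfalso
  have h0 := (hs.hasSum_iff.2 h.symm)
  rw [hasSum_zero_iff_of_nonneg hn] at h0
  have hH0 : H = 0 := hH.trans h.symm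
  have : V = 0 := by
    rw [hV, hH0]
    convert tsum_zero with x
    have := congrFun h0 x
    simp only [one_div, Real.logb_inv, Pi.zero_apply] at this
    rw [sub_zero, sq, ← mul_assoc, this, zero_mul]
  exact hVpos.ne' this
end CLT

section Codes
open Topology

lemma conv_card {α : Type*} {K : ℕ} (hK : 2 ≤ K) (φ : α → Word K) (ψ : Word K → α) (η : ℝ) :
    ∃ F : Finset α, {x | ψ (φ x) = x ∧ wlen (φ x) ≤ η} = F ∧ (F.card : ℝ) ≤ (K : ℝ) ^ (η + 1) := by
  classical
  have hK1 : (1 : ℝ) < K := by exact_mod_cast hK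
  set A := {x | ψ (φ x) = x ∧ wlen (φ x) ≤ η} with hA
  rcases lt_or_ge η 0 with hη | hη
  · refine ⟨∅, ?_, by simp; positivity⟩
    ext x
    simp only [hA, Set.mem_setOf_eq, Finset.coe_empty, Set.mem_empty_iff_false, iff_false, not_and, not_le]
    intro _
    refine hη.trans_le ?_
    simp [wlen]
  set m := ⌊η⌋₊
  let W : Finset (List (Fin K)) := (Finset.range (m + 1)).biUnion
    (fun k => Finset.univ.image (fun v : Fin k → Fin K => List.ofFn v))
  have hW : W.card ≤ K ^ (m + 1) := by
    calc W.card ≤ ∑ k ∈ Finset.range (m + 1), K ^ k := by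
          refine Finset.card_biUnion_le.trans (Finset.sum_le_sum fun k _ => ?_)
          refine Finset.card_image_le.trans ?_
          simp
      _ ≤ K ^ (m + 1) := (Nat.geomSum_lt hK (by simp)).le
  have hinj : Set.InjOn (fun x => (φ x).1) A := by
    intro x hx y hy hxy
    have : φ x = φ y := Subtype.ext hxy
    rw [← hx.1, ← hy.1, this]
  have hmaps : ∀ x ∈ A, (φ x).1 ∈ W := by
    intro x hx
    have h2 : (φ x).1.length ≤ m := Nat.le_floor hx.2
    simp only [W, Finset.mem_biUnion, Finset.mem_range, Finset.mem_image, Finset.mem_univ, true_and]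
    exact ⟨_, Nat.lt_succ_of_le h2, (φ x).1.get, List.ofFn_get _⟩
  have hfin : A.Finite := Set.Finite.of_finite_image
    (W.finite_toSet.subset (by rintro _ ⟨x, hx, rfl⟩; exact hmaps x hx)) hinj
  refine ⟨hfin.toFinset, by simp, ?_⟩
  have h1 : hfin.toFinset.card ≤ W.card := Finset.card_le_card_of_injOn (fun x => (φ x).1)
    (fun x hx => hmaps x (by simpa using hx)) (by simpa using hinj)
  calc (hfin.toFinset.card : ℝ) ≤ (K ^ (m + 1) : ℕ) := by exact_mod_cast h1.trans hW
    _ = (K : ℝ) ^ ((m : ℝ) + 1) := by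
      push_cast; rw [← Real.rpow_natCast]; push_cast; rfl
    _ ≤ _ := Real.rpow_le_rpow_of_exponent_le hK1.le (by linarith [Nat.floor_le hη])

lemma conv_one {α : Type*} {K : ℕ} (hK : 2 ≤ K) (P : Dist α) (φ : α → Word K) (ψ : Word K → α)
    (η s : ℝ) : P.pr {x | P.p x < (K : ℝ) ^ (-(η + s))} ≤
      errP P φ ψ + ovP P φ η + (K : ℝ) ^ (1 - s) := by
  have hK1 : (1 : ℝ) < K := by exact_mod_cast hK
  have hK0 : (0 : ℝ) < K := by linarith
  obtain ⟨F, hF, hc⟩ := conv_card hK φ ψ η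
  classical
  set τ := (K : ℝ) ^ (-(η + s)) with hτ
  set G : Finset α := F.filter (fun x => P.p x < τ) with hG
  have hsub : {x | P.p x < τ} ⊆ ({x | ψ (φ x) ≠ x} ∪ {x | wlen (φ x) > η}) ∪ (G : Set α) := by
    intro x hx
    by_cases h1 : ψ (φ x) = x
    · by_cases h2 : wlen (φ x) ≤ η
      · right
        have : x ∈ (F : Set α) := hF ▸ ⟨h1, h2⟩
        simp only [hG, Finset.coe_filter, Set.mem_setOf_eq]
        exact ⟨by simpa using this, hx⟩
      · left; right; simpa using h2
    · left; left; exact h1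
  have hGp : P.pr (G : Set α) ≤ (K : ℝ) ^ (1 - s) := by
    rw [pr_finset]
    calc ∑ x ∈ G, P.p x ≤ ∑ x ∈ G, τ := Finset.sum_le_sum fun x hx => by
          simp only [hG, Finset.mem_filter] at hx; exact hx.2.le
      _ = G.card * τ := by simp
      _ ≤ (K : ℝ) ^ (η + 1) * τ := by
        refine mul_le_mul_of_nonneg_right (le_trans ?_ hc) (by positivity)
        exact_mod_cast Finset.card_filter_le _ _
      _ = _ := by rw [hτ, ← Real.rpow_add hK0]; congr 1; ring
  calc _ ≤ _ := pr_mono P hsub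
    _ ≤ _ := pr_union_le P _ _
    _ ≤ _ := add_le_add (pr_union_le P _ _) hGp

lemma ach_one {α : Type*} [Countable α] {K : ℕ} (hK : 2 ≤ K) (P : Dist α) (η' η δ : ℝ) (hδ : 0 ≤ δ) :
    ∃ (φ : α → Word K) (ψ : Word K → α), (1 ≤ η' → η' + 1 ≤ η →
      errP P φ ψ ≤ max (P.pr {x | P.p x < (K : ℝ) ^ (-η')} - δ) 0 ∧
      ovP P φ η ≤ δ + (K : ℝ) ^ (-η')) := by
  classical
  have hK1 : (1 : ℝ) < K := by exact_mod_cast hK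
  have hK0 : (0 : ℝ) < K := by linarith
  have hne : Nonempty α := by
    by_contra h
    rw [not_nonempty_iff] at h
    have := P.hasSum.tsum_eq
    simp at this
  let z : Fin K := ⟨0, by omega⟩
  set τ := (K : ℝ) ^ (-η') with hτ
  have hτ0 : 0 < τ := by positivity
  by_cases h1 : 1 ≤ η'
  swap
  · exact ⟨fun _ => ⟨[z], by simp⟩, fun _ => Classical.choice hne, fun h => absurd h h1⟩
  set m := ⌈η'⌉₊ with hm
  have hm1 : 1 ≤ m := by
    rw [hm]; exact Nat.one_le_ceil_iff.2 (by linarith)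
  have hmη : η' ≤ m := Nat.le_ceil _
  have hmη' : (m : ℝ) < η' + 1 := Nat.ceil_lt_add_one (by linarith)
  set A := {x | P.p x < τ} with hA
  obtain ⟨C, hCA, hC1, hC2⟩ := pr_split P A τ δ hτ0.le hδ (fun x hx => le_of_lt hx)
  have hfin : (Aᶜ).Finite := by
    have := P.hasSum.summable.tendsto_cofinite_zero.eventually_lt_const hτ0
    rw [eventually_cofinite] at this
    exact this
  have : Fintype (Aᶜ : Set α) := hfin.fintype
  have hcard : Fintype.card (Aᶜ : Set α) ≤ Fintype.card (Fin m → Fin K) := by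
    have h2 : (hfin.toFinset.card : ℝ) * τ ≤ 1 := by
      have := pr_le_one P (hfin.toFinset : Set α)
      rw [pr_finset] at this
      refine le_trans ?_ this
      rw [← nsmul_eq_mul]
      refine Finset.card_nsmul_le_sum _ _ _ fun x hx => ?_
      simpa [hA] using hx
    have h3 : (hfin.toFinset.card : ℝ) ≤ (K : ℝ) ^ (m : ℝ) := by
      calc (hfin.toFinset.card : ℝ) = (hfin.toFinset.card : ℝ) * τ * (K : ℝ) ^ η' := by
            rw [mul_assoc, hτ, ← Real.rpow_add hK0]; simp
        _ ≤ 1 * (K : ℝ) ^ η' := mul_le_mul_of_nonneg_right h2 (by positivity)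
        _ ≤ _ := by rw [one_mul]; exact Real.rpow_le_rpow_of_exponent_le hK1.le hmη
    rw [Real.rpow_natCast] at h3
    have h4 : Fintype.card (Aᶜ : Set α) = hfin.toFinset.card := by
      rw [← Set.toFinset_card]; congr 1; ext x; simp
    rw [h4]
    simp only [Fintype.card_pi, Fintype.card_fin, Finset.prod_const, Finset.card_univ]
    exact_mod_cast h3
  obtain ⟨e⟩ := Function.Embedding.nonempty_of_card_le hcard
  obtain ⟨g, hg⟩ := exists_injective_nat α
  let φ0 : α → List (Fin K) := fun x =>
    if x ∈ C then List.replicate (m + 1 + g x) z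
    else if h : x ∈ Aᶜ then List.ofFn (e ⟨x, h⟩) else List.replicate m z
  have hlen1 : ∀ x, x ∈ C → (φ0 x).length = m + 1 + g x := fun x hx => by simp [φ0, hx]
  have hlen2 : ∀ x, x ∉ C → (φ0 x).length = m := fun x hx => by
    by_cases h : x ∈ Aᶜ
    · simp only [φ0, hx, h]; simp
    · simp only [φ0, hx, h]; simp
  have hne0 : ∀ x, φ0 x ≠ [] := by
    intro x h
    have h5 : (φ0 x).length = 0 := by simp [h]
    by_cases hx : x ∈ C
    · rw [hlen1 x hx] at h5; omega
    · rw [hlen2 x hx] at h5; omega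
  let φ : α → Word K := fun x => ⟨φ0 x, hne0 x⟩
  have hinj : Set.InjOn φ (C ∪ Aᶜ) := by
    intro x hx y hy hxy
    have h0 : φ0 x = φ0 y := congrArg Subtype.val hxy
    have hl := congrArg List.length h0
    by_cases hxC : x ∈ C <;> by_cases hyC : y ∈ C
    · rw [hlen1 x hxC, hlen1 y hyC] at hl
      exact hg (by omega)
    · rw [hlen1 x hxC, hlen2 y hyC] at hl; omega
    · rw [hlen2 x hxC, hlen1 y hyC] at hl; omega
    · have hxA : x ∈ Aᶜ := hx.resolve_left hxC
      have hyA : y ∈ Aᶜ := hy.resolve_left hyC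
      simp only [φ0, hxC, hyC, hxA, hyA, if_false, dif_pos] at h0
      have := e.injective (List.ofFn_injective h0)
      exact congrArg Subtype.val this
  refine ⟨φ, Function.invFunOn φ (C ∪ Aᶜ), fun _ hη => ⟨?_, ?_⟩⟩
  · refine le_trans (pr_mono P ?_) hC2
    intro x hx
    by_contra hcon
    refine hx (hinj.leftInvOn_invFunOn ?_)
    by_cases hxA : x ∈ A
    · left
      by_contra hxC
      exact hcon ⟨hxA, hxC⟩
    · right; exact hxA
  · refine le_trans (pr_mono P ?_) hC1
    intro x hx
    by_contra hxC
    have : wlen (φ x) = m := by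
      simp only [wlen, φ]; rw [hlen2 x hxC]
    simp only [Set.mem_setOf_eq, this] at hx
    linarith

end Codes

section Main
open Topology

lemma sec_opt {𝒳 : Type*} {K : ℕ} {X : Source 𝒳} {ε δ R L : ℝ} (h : SecondAch K X ε δ R L) :
    OptSecondAch K X ε δ R L := by
  obtain ⟨φ, ψ, h1, h2⟩ := h
  refine ⟨φ, ψ, fun γ hγ => ?_⟩
  have b1 : IsBoundedUnder (· ≤ ·) atTop (fun n => errP (X n) (φ n) (ψ n)) :=
    isBoundedUnder_of ⟨1, fun n => pr_le_one _ _⟩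
  have b2 : IsBoundedUnder (· ≤ ·) atTop
      (fun n => ovP (X n) (φ n) ((n : ℝ) * R + Real.sqrt (n : ℝ) * L)) :=
    isBoundedUnder_of ⟨1, fun n => pr_le_one _ _⟩
  have e1 := eventually_lt_of_limsup_lt (lt_of_le_of_lt h1 (lt_add_of_pos_right ε hγ)) b1
  have e2 := eventually_lt_of_limsup_lt (lt_of_le_of_lt h2 (lt_add_of_pos_right δ hγ)) b2
  obtain ⟨N, hN⟩ := eventually_atTop.1 (e1.and e2)
  refine ⟨fun i => i + N, fun i j hij => by simpa using hij, fun i => ?_⟩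
  have := hN (i + N) (by omega)
  exact ⟨this.1.le, this.2.le⟩

lemma sqrt_nat_top : Tendsto (fun n : ℕ => Real.sqrt (n : ℝ)) atTop atTop :=
  Real.tendsto_sqrt_atTop.comp tendsto_natCast_atTop_atTop

lemma rpow_zero_of_top {K : ℕ} (hK : 2 ≤ K) {f : ℕ → ℝ} (hf : Tendsto f atTop atBot) :
    Tendsto (fun n => (K : ℝ) ^ f n) atTop (𝓝 0) := by
  have hK1 : (1 : ℝ) < K := by exact_mod_cast hK
  exact (tendsto_rpow_atBot_of_base_gt_one (K : ℝ) hK1).comp hf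

lemma converse {𝒳 : Type*} {K : ℕ} (hK : 2 ≤ K) {X : Source 𝒳} {ε δ H V L : ℝ} (hV : 0 < V)
    (h0 : 0 < ε + δ) (h1 : ε + δ < 1)
    (hclt : ∀ L : ℝ, Tendsto (fun n : ℕ => (X n).pr
      {x | (X n).p x < (K : ℝ) ^ (-((n : ℝ) * H + Real.sqrt n * L))})
      atTop (𝓝 (PhiC (L / Real.sqrt V))))
    (h : OptSecondAch K X ε δ H L) : Real.sqrt V * PhiCInv (ε + δ) ≤ L := by
  obtain ⟨φ, ψ, h⟩ := h
  have hsV : 0 < Real.sqrt V := Real.sqrt_pos.2 hV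
  refine le_of_forall_pos_le_add fun c hc => ?_
  have key : PhiC ((L + c) / Real.sqrt V) ≤ ε + δ := by
    refine le_of_forall_pos_le_add fun γ hγ => ?_
    obtain ⟨ns, hns, hi⟩ := h (γ / 2) (by linarith)
    have t1 := (hclt (L + c)).comp hns.tendsto_atTop
    have t2 : Tendsto (fun n : ℕ => (K : ℝ) ^ (1 - Real.sqrt n * c)) atTop (𝓝 0) := by
      refine rpow_zero_of_top hK ?_
      exact tendsto_atBot_add_const_left _ 1 (tendsto_neg_atTop_atBot.comp (sqrt_nat_top.atTop_mul_const hc))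
    have t3 := (t2.comp hns.tendsto_atTop).const_add (ε + δ + γ)
    rw [add_zero] at t3
    refine le_of_tendsto_of_tendsto' t1 t3 fun i => ?_
    have := conv_one hK (X (ns i)) (φ (ns i)) (ψ (ns i)) ((ns i : ℝ) * H + Real.sqrt (ns i : ℝ) * L)
      (Real.sqrt (ns i : ℝ) * c)
    rw [show (ns i : ℝ) * H + Real.sqrt (ns i : ℝ) * L + Real.sqrt (ns i : ℝ) * c =
      (ns i : ℝ) * H + Real.sqrt (ns i : ℝ) * (L + c) by ring] at this
    simp only [Function.comp]
    linarith [(hi i).1, (hi i).2]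
  rw [← PhiC_PhiCInv h0 h1, PhiC_strictAnti.le_iff_ge, le_div_iff₀ hsV] at key
  linarith

lemma achiev {𝒳 : Type*} [Countable 𝒳] {K : ℕ} (hK : 2 ≤ K) {X : Source 𝒳} {ε δ H V L : ℝ}
    (hV : 0 < V) (hH : 0 < H) (hε : 0 ≤ ε) (hδ : 0 ≤ δ)
    (h0 : 0 < ε + δ) (h1 : ε + δ < 1)
    (hclt : ∀ L : ℝ, Tendsto (fun n : ℕ => (X n).pr
      {x | (X n).p x < (K : ℝ) ^ (-((n : ℝ) * H + Real.sqrt n * L))})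
      atTop (𝓝 (PhiC (L / Real.sqrt V))))
    (h : Real.sqrt V * PhiCInv (ε + δ) < L) : SecondAch K X ε δ H L := by
  have hsV : 0 < Real.sqrt V := Real.sqrt_pos.2 hV
  obtain ⟨L', hL1, hL2⟩ := exists_between h
  choose φ ψ hc using fun n : ℕ => ach_one hK (X n) ((n : ℝ) * H + Real.sqrt n * L')
    ((n : ℝ) * H + Real.sqrt n * L) δ hδ
  have hlt : PhiC (L' / Real.sqrt V) < ε + δ := by
    rw [← PhiC_PhiCInv h0 h1, PhiC_strictAnti.lt_iff_gt, lt_div_iff₀ hsV]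
    linarith
  have ht : Tendsto (fun n : ℕ => (n : ℝ) * H + Real.sqrt n * L') atTop atTop := by
    have e1 : Tendsto (fun n : ℕ => Real.sqrt n * (Real.sqrt n * H + L')) atTop atTop :=
      sqrt_nat_top.atTop_mul_atTop₀ (tendsto_atTop_add_const_right _ _ (sqrt_nat_top.atTop_mul_const hH))
    refine e1.congr fun n => ?_
    have := Real.mul_self_sqrt (Nat.cast_nonneg (α := ℝ) n)
    linear_combination H * this
  have v1 := ht.eventually_ge_atTop 1
  have v2 := (sqrt_nat_top.atTop_mul_const (sub_pos.2 hL2)).eventually_ge_atTop 1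
  have v3 := (hclt L').eventually_lt_const hlt
  have hz := rpow_zero_of_top hK (tendsto_neg_atTop_atBot.comp ht)
  refine ⟨φ, ψ, ?_, ?_⟩
  · refine limsup_le_of_le (isBoundedUnder_of ⟨0, fun n => pr_nonneg _ _⟩).isCoboundedUnder_le ?_
    filter_upwards [v1, v2, v3] with n a1 a2 a3
    refine (hc n a1 (by linarith)).1.trans (max_le (by linarith) hε)
  · refine le_of_forall_pos_le_add fun γ hγ => ?_
    refine limsup_le_of_le (isBoundedUnder_of ⟨0, fun n => pr_nonneg _ _⟩).isCoboundedUnder_le ?_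
    filter_upwards [v1, v2, hz.eventually_lt_const hγ] with n a1 a2 a3
    refine (hc n a1 (by linarith)).2.trans ?_
    simp only [Function.comp] at a3
    linarith
end Main

/-- stationary memoryless sources, second order at the first-order
optimum threshold R₁ = H(X):
L(ε,δ,R₁|X) = L*(ε,δ,R₁|X) = √V_X · Φ⁻¹(ε+δ). -/
theorem statement19 {𝒳 : Type*} [Countable 𝒳] (K : ℕ) (hK : 2 ≤ K)
    (pX : Dist 𝒳) (X : Source 𝒳)
    (hX : ∀ (n : ℕ) (x : Fin n → 𝒳), (X n).p x = ∏ i, pX.p (x i))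
    (hmom : Summable fun x => pX.p x * |Real.logb (K : ℝ) (1 / pX.p x)| ^ 3)
    (H V : ℝ) (hH : H = ∑' x, pX.p x * Real.logb (K : ℝ) (1 / pX.p x))
    (hV : V = ∑' x, pX.p x * (-Real.logb (K : ℝ) (pX.p x) - H) ^ 2) (hVpos : 0 < V)
    (ε δ : ℝ) (hε0 : 0 ≤ ε) (hε1 : ε < 1) (hδ0 : 0 ≤ δ) (hδ1 : δ < 1)
    (hεδ0 : 0 < ε + δ) (hεδ : ε + δ < 1) :
    Lopt K X ε δ H = Real.sqrt V * PhiCInv (ε + δ) ∧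
    LoptStar K X ε δ H = Real.sqrt V * PhiCInv (ε + δ) := by
  have hclt := clt K hK pX X hX hmom H V hH hV hVpos
  have hHp := H_pos K hK pX hmom H V hH hV hVpos
  have hc : ∀ L, OptSecondAch K X ε δ H L → Real.sqrt V * PhiCInv (ε + δ) ≤ L :=
    fun L h => converse hK hVpos hεδ0 hεδ hclt h
  have ha : ∀ L, Real.sqrt V * PhiCInv (ε + δ) < L → SecondAch K X ε δ H L :=
    fun L h => achiev hK hVpos hHp hε0 hδ0 hεδ0 hεδ hclt h
  constructor
  · refine csInf_eq_of_forall_ge_of_forall_gt_exists_lt ⟨_, ha _ (lt_add_one _)⟩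
      (fun L h => hc L (sec_opt h)) (fun w hw => ?_)
    obtain ⟨L, h1, h2⟩ := exists_between hw
    exact ⟨L, ha L h1, h2⟩
  · refine csInf_eq_of_forall_ge_of_forall_gt_exists_lt ⟨_, sec_opt (ha _ (lt_add_one _))⟩
      (fun L h => hc L h) (fun w hw => ?_)
    obtain ⟨L, h1, h2⟩ := exists_between hw
    exact ⟨L, sec_opt (ha L h1), h2⟩
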